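/- Let M be a unitary magma. A binary tree t with internal nodes labeled by M³ is a normal form for the one-step rewrite relation ⇒ (i.e., there is no t' with t ⇒ t') if and only if: (i) every internal node of t other than the root has its first label component (base) equal to 1_M; and (ii) every internal node of t whose left child is an internal node has its second label component (first edge) different from 1_M. -/

import Mathlib

/-! Plane rooted binary trees with internal nodes labeled by `M`-triangles
(triples in `M³`), and the one-step rewrite relation `⇒` on them, for a unitary
magma `M` (modeled as `MulOneClass`). -/

/-- Binary trees with internal nodes labeled by `M³`. -/
inductive BT (M : Type) : Type
  | leaf : BT M
  | node : (M × M × M) → BT M → BT M → BT M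

namespace BT

variable {M : Type} [MulOneClass M]

/-- The one-step rewrite relation `⇒`: apply one of the rules (R1), (R2), (R3)
at any position inside a tree. -/
inductive Step : BT M → BT M → Prop
  | R1 (p q : M × M × M) (l1 l2 r : BT M) (h : q.1 ≠ 1) :
      Step (node p (node q l1 l2) r)
        (node (p.1, p.2.1 * q.1, p.2.2) (node (1, q.2.1, q.2.2) l1 l2) r)
  | R2 (p q : M × M × M) (l1 l2 r : BT M) (h : p.2.1 * q.1 = 1) :
      Step (node p (node q l1 l2) r)
        (node (p.1, q.2.1, 1) l1 (node (1, q.2.2, p.2.2) l2 r))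
  | R3 (p q : M × M × M) (l r1 r2 : BT M) (h : q.1 ≠ 1) :
      Step (node p l (node q r1 r2))
        (node (p.1, p.2.1, p.2.2 * q.1) l (node (1, q.2.1, q.2.2) r1 r2))
  | left (p : M × M × M) (l l' r : BT M) :
      Step l l' → Step (node p l r) (node p l' r)
  | right (p : M × M × M) (l r r' : BT M) :
      Step r r' → Step (node p l r) (node p l r')

end BT

namespace BT

/-- A tree is internal when it is a node. -/
def IsNode {M : Type} : BT M → Prop
  | leaf => False
  | node _ _ _ => True

/-- The normal-form condition for strict subtrees (whose roots are non-root internal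
nodes): the root label has first component (base) equal to `1`, its second component
(first edge) is different from `1` whenever the left child is internal, and the same
holds recursively below. -/
def NFSub {M : Type} [One M] : BT M → Prop
  | leaf => True
  | node p l r => p.1 = 1 ∧ (IsNode l → p.2.1 ≠ 1) ∧ NFSub l ∧ NFSub r

/-- The normal-form condition: every internal node other than the root has base
label `1`, and every internal node whose left child is internal has its first-edge
label different from `1` (no constraint on the base label of the root). -/
def NFCond {M : Type} [One M] : BT M → Prop
  | leaf => True
  | node p l r => (IsNode l → p.2.1 ≠ 1) ∧ NFSub l ∧ NFSub r

end BT

namespace BT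

/-- A strict subtree meets its normal-form condition when it meets the root condition
and its own base label, if any, equals `1`. -/
theorem NFSub.of_nfCond {M : Type} [One M] {t : BT M} (ht : NFCond t)
    (hbase : ∀ p l r, t = node p l r → p.1 = 1) : NFSub t := by
  cases t with
  | leaf => trivial
  | node p l r => exact ⟨hbase p l r rfl, ht⟩

theorem NFSub.nfCond {M : Type} [One M] {t : BT M} (ht : NFSub t) : NFCond t := by
  cases t with
  | leaf => trivial
  | node p l r => exact ht.2

theorem nfCond_of_forall_not_step {M : Type} [MulOneClass M] {t : BT M}
    (ht : ∀ t', ¬ Step t t') : NFCond t := by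
  induction t with
  | leaf => trivial
  | node p l r ihl ihr =>
    have hl : ∀ q l₁ l₂, l = node q l₁ l₂ → q.1 = 1 := by
      rintro q l₁ l₂ rfl
      by_contra h
      exact ht _ (.R1 p q l₁ l₂ r h)
    have hr : ∀ q r₁ r₂, r = node q r₁ r₂ → q.1 = 1 := by
      rintro q r₁ r₂ rfl
      by_contra h
      exact ht _ (.R3 p q l r₁ r₂ h)
    refine ⟨fun hnode hp => ?_,
      .of_nfCond (ihl fun l' h => ht _ (.left p l l' r h)) hl,
      .of_nfCond (ihr fun r' h => ht _ (.right p l r r' h)) hr⟩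
    cases l with
    | leaf => exact hnode
    | node q l₁ l₂ =>
      exact ht _ (.R2 p q l₁ l₂ r (by rw [hp, hl q l₁ l₂ rfl, one_mul]))

theorem Step.not_nfCond {M : Type} [MulOneClass M] {t t' : BT M} (h : Step t t') :
    ¬ NFCond t := by
  induction h with
  | R1 p q l₁ l₂ r h => exact fun ht => h ht.2.1.1
  | R2 p q l₁ l₂ r h =>
    intro ht
    rw [ht.2.1.1, mul_one] at h
    exact ht.1 trivial h
  | R3 p q l r₁ r₂ h => exact fun ht => h ht.2.2.1
  | left p l l' r _ ih => exact fun ht => ih ht.2.1.nfCond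
  | right p l r r' _ ih => exact fun ht => ih ht.2.2.nfCond

end BT

/-- A tree is a normal form for `⇒` (it cannot be rewritten) if and only if it
satisfies conditions (i) and (ii). -/
theorem statement8 (M : Type) [MulOneClass M] (t : BT M) :
    (∀ t' : BT M, ¬ BT.Step t t') ↔ BT.NFCond t :=
  ⟨BT.nfCond_of_forall_not_step, fun ht _ h => h.not_nfCond ht⟩
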